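/- Let G be a finite graph with a percolation measure, 0, b vertices, v and a two neighbours of 0 with P_{G∖{0}}(a↔b) ≤ P_{G∖{0}}(v↔b). Let B be a set of neighbours of 0 with v ∈ B and let σ_B be the event that all edges from 0 to vertices of B are open and all other edges incident to 0 are closed. Then P(a↔b, σ_B) ≤ P(0↔b, σ_B). -/

import Mathlib

open scoped BigOperators

structure PercGraph (V E : Type) where
  ends : E → V × V
  p : E → ℝ

namespace PercGraph

variable {V E : Type} [DecidableEq V] [Fintype E] [DecidableEq E]

/-- Weight of a configuration: each edge `e` is open (`ω e = true`) with probability `p e`. -/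
def weight (G : PercGraph V E) (ω : E → Bool) : ℝ :=
  ∏ e, if ω e then G.p e else 1 - G.p e

/-- Probability of an event under the percolation measure. -/
noncomputable def prob (G : PercGraph V E) (S : Set (E → Bool)) : ℝ :=
  ∑ ω : E → Bool, Set.indicator S G.weight ω

/-- Expectation of a function under the percolation measure. -/
noncomputable def expec (G : PercGraph V E) (f : (E → Bool) → ℝ) : ℝ :=
  ∑ ω : E → Bool, f ω * G.weight ω

/-- Two vertices are adjacent via an open edge in configuration `ω`. -/
def adj (G : PercGraph V E) (ω : E → Bool) (x y : V) : Prop :=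
  ∃ e, ω e = true ∧ (G.ends e = (x, y) ∨ G.ends e = (y, x))

/-- `x` and `y` are connected by a path of open edges. -/
def Conn (G : PercGraph V E) (ω : E → Bool) (x y : V) : Prop :=
  Relation.ReflTransGen (G.adj ω) x y

/-- The union of the open clusters of the vertices of `A`. -/
def cluster (G : PercGraph V E) (ω : E → Bool) (A : Set V) : Set V :=
  {y | ∃ a ∈ A, G.Conn ω a y}

/-- The event `x ↔ y`. -/
def connEvent (G : PercGraph V E) (x y : V) : Set (E → Bool) :=
  {ω | G.Conn ω x y}

/-- The event `x ↔ A`. -/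
def connTo (G : PercGraph V E) (x : V) (A : Set V) : Set (E → Bool) :=
  {ω | ∃ a ∈ A, G.Conn ω x a}

/-- The event `A ↮ B`. -/
def disconn (G : PercGraph V E) (A B : Set V) : Set (E → Bool) :=
  {ω | ∀ a ∈ A, ∀ b ∈ B, ¬ G.Conn ω a b}

def IncreasingEvent (S : Set (E → Bool)) : Prop :=
  ∀ ⦃ω ω' : E → Bool⦄, (∀ e, ω e = true → ω' e = true) → ω ∈ S → ω' ∈ S

def DecreasingEvent (S : Set (E → Bool)) : Prop :=
  ∀ ⦃ω ω' : E → Bool⦄, (∀ e, ω e = true → ω' e = true) → ω' ∈ S → ω ∈ S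

def IncreasingFun (f : (E → Bool) → ℝ) : Prop :=
  ∀ ⦃ω ω' : E → Bool⦄, (∀ e, ω e = true → ω' e = true) → f ω ≤ f ω'

/-- `f` is determined by the cluster of `A`. -/
def ClusterDetermined (G : PercGraph V E) (A : Set V) (f : (E → Bool) → ℝ) : Prop :=
  ∀ ω ω', G.cluster ω A = G.cluster ω' A → f ω = f ω'

/-- The event `S` is determined by the cluster of `A`. -/
def ClusterDeterminedEvent (G : PercGraph V E) (A : Set V) (S : Set (E → Bool)) : Prop :=
  ∀ ω ω', G.cluster ω A = G.cluster ω' A → (ω ∈ S ↔ ω' ∈ S)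

noncomputable def condProb (G : PercGraph V E) (S T : Set (E → Bool)) : ℝ :=
  G.prob (S ∩ T) / G.prob T

noncomputable def condExpec (G : PercGraph V E) (f : (E → Bool) → ℝ) (T : Set (E → Bool)) : ℝ :=
  G.expec (T.indicator f) / G.prob T

/-- The edge `e` is incident to the vertex `x`. -/
def incident (G : PercGraph V E) (x : V) (e : E) : Prop :=
  (G.ends e).1 = x ∨ (G.ends e).2 = x

/-- The other endpoint of an edge incident to `x`. -/
def otherEnd (G : PercGraph V E) (x : V) (e : E) : V :=
  if (G.ends e).1 = x then (G.ends e).2 else (G.ends e).1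

/-- The graph `G ∖ W`: delete the vertices of `W` and all incident edges. -/
def delete (G : PercGraph V E) (W : Finset V) :
    PercGraph V {e : E // (G.ends e).1 ∉ W ∧ (G.ends e).2 ∉ W} :=
  ⟨fun e => G.ends e.1, fun e => G.p e.1⟩

/-- The graph `G` with the probability of edge `e` replaced by `q`. -/
def withEdgeProb (G : PercGraph V E) (e : E) (q : ℝ) : PercGraph V E :=
  ⟨G.ends, Function.update G.p e q⟩

/-- Contraction of the edge `e`: set its probability to 1. -/
def contract (G : PercGraph V E) (e : E) : PercGraph V E :=
  G.withEdgeProb e 1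

/-- The event that `e` is pivotal for `U`. -/
def pivotal (e : E) (U : Set (E → Bool)) : Set (E → Bool) :=
  {ω | ¬ ((Function.update ω e true ∈ U) ↔ (Function.update ω e false ∈ U))}

/-- All edge probabilities lie in `[0,1]`. -/
def ProbValid (G : PercGraph V E) : Prop := ∀ e, 0 ≤ G.p e ∧ G.p e ≤ 1

end PercGraph

namespace PercGraph

/-- The real-valued indicator of a proposition. -/
noncomputable def ind (P : Prop) : ℝ := by
  classical exact if P then 1 else 0

theorem ind_of_true {P : Prop} (h : P) : ind P = 1 := by simp [ind, h]

theorem ind_of_false {P : Prop} (h : ¬ P) : ind P = 0 := by simp [ind, h]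

theorem ind_nonneg (P : Prop) : 0 ≤ ind P := by
  by_cases h : P <;> simp [ind, h]

theorem ind_mono {P Q : Prop} (h : P → Q) : ind P ≤ ind Q := by
  by_cases hP : P
  · rw [ind_of_true hP, ind_of_true (h hP)]
  · rw [ind_of_false hP]; exact ind_nonneg Q

theorem ind_and (P Q : Prop) : ind (P ∧ Q) = ind P * ind Q := by
  by_cases hP : P <;> by_cases hQ : Q <;> simp [ind, hP, hQ]

section Expectation

variable {V E : Type} [Fintype E]

theorem weight_nonneg {G : PercGraph V E} (hp : G.ProbValid) (ω : E → Bool) :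
    0 ≤ G.weight ω := by
  refine Finset.prod_nonneg fun e _ => ?_
  split_ifs
  · exact (hp e).1
  · linarith [(hp e).2]

variable [DecidableEq E]

theorem expec_mono {G : PercGraph V E} (hp : G.ProbValid) {f g : (E → Bool) → ℝ}
    (h : ∀ ω, f ω ≤ g ω) : G.expec f ≤ G.expec g :=
  Finset.sum_le_sum fun ω _ => mul_le_mul_of_nonneg_right (h ω) (weight_nonneg hp ω)

theorem expec_nonneg {G : PercGraph V E} (hp : G.ProbValid) {f : (E → Bool) → ℝ}
    (h : ∀ ω, 0 ≤ f ω) : 0 ≤ G.expec f :=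
  Finset.sum_nonneg fun ω _ => mul_nonneg (h ω) (weight_nonneg hp ω)

theorem expec_add (G : PercGraph V E) (f g : (E → Bool) → ℝ) :
    G.expec (fun ω => f ω + g ω) = G.expec f + G.expec g := by
  simp [expec, add_mul, Finset.sum_add_distrib]

theorem expec_const_mul (G : PercGraph V E) (c : ℝ) (f : (E → Bool) → ℝ) :
    G.expec (fun ω => c * f ω) = c * G.expec f := by
  simp [expec, mul_assoc, Finset.mul_sum]

theorem expec_neg (G : PercGraph V E) (f : (E → Bool) → ℝ) :
    G.expec (fun ω => - f ω) = - G.expec f := by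
  simp [expec]

theorem expec_one (G : PercGraph V E) : G.expec (fun _ => 1) = 1 := by
  have h := Finset.prod_univ_sum (fun _ : E => (Finset.univ : Finset Bool))
    (fun e b => if b then G.p e else 1 - G.p e)
  simp only [Fintype.piFinset_univ] at h
  simp only [expec, one_mul, weight]
  rw [← h]
  simp

theorem prob_eq_expec (G : PercGraph V E) (S : Set (E → Bool)) :
    G.prob S = G.expec (fun ω => ind (ω ∈ S)) := by
  refine Finset.sum_congr rfl fun ω _ => ?_
  by_cases h : ω ∈ S <;> simp [ind, h]

/-- Conditioning on the state of the edge `e`. -/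
theorem expec_update (G : PercGraph V E) (e : E) (f : (E → Bool) → ℝ) :
    G.expec f = G.p e * G.expec (fun ω => f (Function.update ω e true))
      + (1 - G.p e) * G.expec (fun ω => f (Function.update ω e false)) := by
  have hw : ∀ ω : E → Bool, G.weight ω = (if ω e then G.p e else 1 - G.p e) *
      ∏ i ∈ Finset.univ.erase e, if ω i then G.p i else 1 - G.p i := fun ω =>
    (Finset.mul_prod_erase _ _ (Finset.mem_univ e)).symm
  have hr : ∀ (ω : E → Bool) (b : Bool),
      (∏ i ∈ Finset.univ.erase e, if Function.update ω e b i then G.p i else 1 - G.p i)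
        = ∏ i ∈ Finset.univ.erase e, if ω i then G.p i else 1 - G.p i := by
    intro ω b
    refine Finset.prod_congr rfl fun i hi => ?_
    rw [Function.update_of_ne (Finset.ne_of_mem_erase hi)]
  have key : ∀ h : (E → Bool) → ℝ, G.expec h = ∑ η : {j // j ≠ e} → Bool,
      (h ((Equiv.funSplitAt e Bool).symm (true, η)) * G.p e *
        (∏ i ∈ Finset.univ.erase e, if (Equiv.funSplitAt e Bool).symm (true, η) i
          then G.p i else 1 - G.p i)
      + h (Function.update ((Equiv.funSplitAt e Bool).symm (true, η)) e false) * (1 - G.p e) *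
        (∏ i ∈ Finset.univ.erase e, if (Equiv.funSplitAt e Bool).symm (true, η) i
          then G.p i else 1 - G.p i)) := by
    intro h
    have hu : ∀ η : {j // j ≠ e} → Bool, (Equiv.funSplitAt e Bool).symm (false, η)
        = Function.update ((Equiv.funSplitAt e Bool).symm (true, η)) e false := by
      intro η
      funext i
      by_cases hi : i = e
      · subst hi; simp [Equiv.funSplitAt]
      · simp [Equiv.funSplitAt, hi]
    rw [expec, ← Equiv.sum_comp (Equiv.funSplitAt e Bool).symm, Fintype.sum_prod_type_right]
    refine Finset.sum_congr rfl fun η _ => ?_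
    rw [Fintype.sum_bool, hu, hw, hw (Function.update _ _ _), hr]
    have ht : (Equiv.funSplitAt e Bool).symm (true, η) e = true := by simp [Equiv.funSplitAt]
    simp only [ht, Function.update_self, if_true]
    simp only [Bool.false_eq_true, if_false]
    ring
  rw [key f, key, key, Finset.mul_sum, Finset.mul_sum, ← Finset.sum_add_distrib]
  refine Finset.sum_congr rfl fun η _ => ?_
  have ht : Function.update ((Equiv.funSplitAt e Bool).symm (true, η)) e true
      = (Equiv.funSplitAt e Bool).symm (true, η) := by
    rw [Function.update_eq_self_iff]; simp [Equiv.funSplitAt]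
  simp only [Function.update_idem, ht]
  ring

end Expectation

section Cluster

variable {V E : Type}

/-- The edge `e` joins `x` and `y`. -/
def Joins (G : PercGraph V E) (e : E) (x y : V) : Prop :=
  G.ends e = (x, y) ∨ G.ends e = (y, x)

theorem Joins.symm {G : PercGraph V E} {e : E} {x y : V} (h : G.Joins e x y) : G.Joins e y x := Or.symm h

theorem Joins.eq_or_eq {G : PercGraph V E} {e : E} {x y x' y' : V} (h : G.Joins e x y) (h' : G.Joins e x' y') :
    (x' = x ∧ y' = y) ∨ (x' = y ∧ y' = x) := by
  unfold Joins at h h'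
  rcases h with h | h <;> rw [h] at h' <;> simp only [Prod.mk.injEq] at h' <;> grind

theorem Conn.symm {G : PercGraph V E} {ω : E → Bool} {x y : V} (h : G.Conn ω x y) : G.Conn ω y x := by
  induction h with
  | refl => exact .refl
  | tail _ h ih =>
    obtain ⟨e, ho, hj⟩ := h
    exact Relation.ReflTransGen.head ⟨e, ho, hj.symm⟩ ih

theorem Conn.of_delete {G : PercGraph V E} {W : Finset V} {ω : E → Bool} {x y : V}
    (h : (G.delete W).Conn (fun e => ω e.1) x y) : G.Conn ω x y :=
  Relation.ReflTransGen.mono (fun _ _ ⟨e, ho, hj⟩ => ⟨e.1, ho, hj⟩) _ _ h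

theorem Conn.notMem_of_delete {G : PercGraph V E} {W : Finset V}
    {η : {e : E // (G.ends e).1 ∉ W ∧ (G.ends e).2 ∉ W} → Bool} {x y : V}
    (hx : x ∉ W) (h : (G.delete W).Conn η x y) : y ∉ W := by
  cases h with
  | refl => exact hx
  | tail _ h =>
    obtain ⟨e, -, hj⟩ := h
    change G.ends e.1 = _ ∨ G.ends e.1 = _ at hj
    have he := e.2
    rcases hj with hj | hj <;> rw [hj] at he
    · exact he.2
    · exact he.1

/-- The edges of `F` with no endpoint in `S`. -/
noncomputable def avoid (G : PercGraph V E) (F : Finset E) (S : Set V) : Finset E := by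
  classical exact F.filter fun e => (G.ends e).1 ∉ S ∧ (G.ends e).2 ∉ S

theorem mem_avoid {G : PercGraph V E} {F : Finset E} {S : Set V} {e : E} :
    e ∈ G.avoid F S ↔ e ∈ F ∧ (G.ends e).1 ∉ S ∧ (G.ends e).2 ∉ S := by
  simp [avoid]

theorem avoid_eq_self {G : PercGraph V E} {F : Finset E} {S : Set V}
    (h : ∀ e ∈ F, ∀ x y, G.Joins e x y → x ∉ S) : G.avoid F S = F := by
  ext i
  rw [mem_avoid]
  exact ⟨fun h => h.1, fun hi => ⟨hi, h i hi _ _ (Or.inl rfl), h i hi _ _ (Or.inr rfl)⟩⟩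

variable [DecidableEq E]

/-- The configuration in which the edges outside `F` are closed. -/
def restrict (F : Finset E) (ω : E → Bool) : E → Bool := fun e => ω e && decide (e ∈ F)

/-- The open cluster of `A` using only edges of `F`. -/
def clusterIn (G : PercGraph V E) (F : Finset E) (ω : E → Bool) (A : Set V) : Set V :=
  G.cluster (restrict F ω) A

variable {G : PercGraph V E} {F F' : Finset E} {ω ω' : E → Bool} {A A' S T : Set V}
  {e : E} {x y : V}

theorem subset_clusterIn : A ⊆ G.clusterIn F ω A := fun a ha => ⟨a, ha, .refl⟩

theorem mem_clusterIn_of_joins (hx : x ∈ G.clusterIn F ω A) (he : e ∈ F) (ho : ω e = true)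
    (hj : G.Joins e x y) : y ∈ G.clusterIn F ω A := by
  obtain ⟨a, ha, hax⟩ := hx
  exact ⟨a, ha, hax.tail ⟨e, by simp [restrict, he, ho], hj⟩⟩

theorem clusterIn_subset (hA : A ⊆ S)
    (hS : ∀ e ∈ F, ω e = true → ∀ x y, G.Joins e x y → x ∈ S → y ∈ S) :
    G.clusterIn F ω A ⊆ S := by
  rintro z ⟨a, ha, haz⟩
  induction haz with
  | refl => exact hA ha
  | tail _ h ih =>
    obtain ⟨e, ho, hj⟩ := h
    simp only [restrict, Bool.and_eq_true, decide_eq_true_eq] at ho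
    exact hS e ho.2 ho.1 _ _ hj ih

theorem clusterIn_mono (hA : A ⊆ A') (hF : ∀ e ∈ F, ω e = true → e ∈ F' ∧ ω' e = true) :
    G.clusterIn F ω A ⊆ G.clusterIn F' ω' A' :=
  clusterIn_subset (hA.trans subset_clusterIn) fun e he ho _ _ hj hx =>
    mem_clusterIn_of_joins hx (hF e he ho).1 (hF e he ho).2 hj

theorem disjoint_clusterIn_comm :
    Disjoint (G.clusterIn F ω A) T ↔ Disjoint (G.clusterIn F ω T) A := by
  have key : ∀ {A T : Set V}, Disjoint (G.clusterIn F ω A) T →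
      Disjoint (G.clusterIn F ω T) A := by
    intro A T h
    have hsub : G.clusterIn F ω T ⊆ (G.clusterIn F ω A)ᶜ :=
      clusterIn_subset h.subset_compl_left fun e he ho x y hj hx hy =>
        hx (mem_clusterIn_of_joins hy he ho hj.symm)
    exact (Set.disjoint_compl_left_iff_subset.2 subset_clusterIn).mono_left hsub
  exact ⟨key, key⟩

theorem clusterIn_eq_self (h : ∀ e ∈ F, ∀ x y, G.Joins e x y → x ∉ A) :
    G.clusterIn F ω A = A :=
  (clusterIn_subset subset_rfl fun e he _ x y hj hx => absurd hx (h e he x y hj)).antisymm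
    subset_clusterIn

theorem clusterIn_update_false :
    G.clusterIn F (Function.update ω e false) A = G.clusterIn (F.erase e) ω A := by
  apply Set.Subset.antisymm
  · refine clusterIn_mono subset_rfl fun i hi ho => ?_
    by_cases h : i = e
    · subst h; simp at ho
    · rw [Function.update_of_ne h] at ho
      exact ⟨Finset.mem_erase.2 ⟨h, hi⟩, ho⟩
  · refine clusterIn_mono subset_rfl fun i hi ho => ?_
    rw [Function.update_of_ne (Finset.ne_of_mem_erase hi)]
    exact ⟨Finset.mem_of_mem_erase hi, ho⟩

theorem clusterIn_erase_subset_update_true :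
    G.clusterIn (F.erase e) ω A ⊆ G.clusterIn F (Function.update ω e true) A := by
  refine clusterIn_mono subset_rfl fun i hi ho => ?_
  rw [Function.update_of_ne (Finset.ne_of_mem_erase hi)]
  exact ⟨Finset.mem_of_mem_erase hi, ho⟩

theorem clusterIn_update_true (he : e ∈ F) (hj : G.Joins e x y) (hx : x ∈ A) :
    G.clusterIn F (Function.update ω e true) A = G.clusterIn (F.erase e) ω (insert y A) := by
  apply Set.Subset.antisymm
  · refine clusterIn_subset ((Set.subset_insert _ _).trans subset_clusterIn) ?_
    intro i hi ho x' y' hj' hx'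
    by_cases h : i = e
    · subst h
      rcases hj.eq_or_eq hj' with ⟨-, rfl⟩ | ⟨-, rfl⟩
      · exact subset_clusterIn (Set.mem_insert _ _)
      · exact subset_clusterIn (Set.mem_insert_of_mem _ hx)
    · rw [Function.update_of_ne h] at ho
      exact mem_clusterIn_of_joins hx' (Finset.mem_erase.2 ⟨h, hi⟩) ho hj'
  · refine clusterIn_subset (Set.insert_subset ?_ subset_clusterIn) ?_
    · exact mem_clusterIn_of_joins (subset_clusterIn hx) he (by simp) hj
    · intro i hi ho x' y' hj' hx'
      refine mem_clusterIn_of_joins hx' (Finset.mem_of_mem_erase hi) ?_ hj'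
      rwa [Function.update_of_ne (Finset.ne_of_mem_erase hi)]

theorem disjoint_clusterIn_update_true (he : e ∈ F) (hj : G.Joins e x y) (hx : x ∈ T) :
    Disjoint (G.clusterIn F (Function.update ω e true) A) T ↔
      Disjoint (G.clusterIn (F.erase e) ω A) (insert y T) := by
  rw [disjoint_clusterIn_comm, clusterIn_update_true he hj hx, disjoint_clusterIn_comm]

theorem clusterIn_update_true_of_disjoint (hj : G.Joins e x y) (hx : x ∈ T)
    (hd : Disjoint (G.clusterIn (F.erase e) ω A) (insert y T)) :
    G.clusterIn F (Function.update ω e true) A = G.clusterIn (F.erase e) ω A := by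
  refine Set.Subset.antisymm (clusterIn_subset subset_clusterIn ?_)
    clusterIn_erase_subset_update_true
  intro i hi ho x' y' hj' hx'
  by_cases h : i = e
  · subst h
    have hx'' := Set.disjoint_left.1 hd hx'
    rcases hj.eq_or_eq hj' with ⟨rfl, -⟩ | ⟨rfl, -⟩
    · exact absurd (Set.mem_insert_of_mem _ hx) hx''
    · exact absurd (Set.mem_insert _ _) hx''
  · rw [Function.update_of_ne h] at ho
    exact mem_clusterIn_of_joins hx' (Finset.mem_erase.2 ⟨h, hi⟩) ho hj'

theorem avoid_erase (hj : G.Joins e x y) (hx : x ∈ S) :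
    G.avoid (F.erase e) S = G.avoid F S := by
  ext i
  rw [mem_avoid, mem_avoid, Finset.mem_erase]
  refine ⟨fun h => ⟨h.1.2, h.2⟩, fun h => ⟨⟨?_, h.1⟩, h.2⟩⟩
  rintro rfl
  rcases hj with h' | h' <;> simp [h', hx] at h

end Cluster

section ConditionalAssociation

variable {V E : Type} [Fintype E] [DecidableEq E] {G : PercGraph V E}

/-- The expectation of a function of the cluster of `A` in the graph with the vertices of `S`
removed. -/
noncomputable def expecAvoiding (G : PercGraph V E) (F : Finset E) (A : Set V) (f : Set V → ℝ)
    (S : Set V) : ℝ :=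
  G.expec fun ω => f (G.clusterIn (G.avoid F S) ω A)

theorem expecAvoiding_antitone (hp : G.ProbValid) (F : Finset E) (A : Set V) {f : Set V → ℝ}
    (hf : Monotone f) : Antitone (G.expecAvoiding F A f) := by
  intro S S' hS
  refine expec_mono hp fun ω => hf (clusterIn_mono subset_rfl fun e he ho => ⟨?_, ho⟩)
  rw [mem_avoid] at he ⊢
  exact ⟨he.1, fun h => he.2.1 (hS h), fun h => he.2.2 (hS h)⟩

theorem expecAvoiding_mono_left (hp : G.ProbValid) (F : Finset E) {A A' : Set V}
    {f : Set V → ℝ} (hf : Monotone f) (hA : A ⊆ A') (S : Set V) :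
    G.expecAvoiding F A f S ≤ G.expecAvoiding F A' f S :=
  expec_mono hp fun _ => hf (clusterIn_mono hA fun _ he ho => ⟨he, ho⟩)

/-- Spatial Markov property: given the cluster of `T`, the cluster of a set `A` disjoint from it
is distributed as in the graph with the cluster of `T` removed. -/
theorem expec_disjoint_clusters (G : PercGraph V E) (F : Finset E) (A T : Set V)
    (f u : Set V → ℝ) :
    G.expec (fun ω => ind (Disjoint (G.clusterIn F ω A) T) *
        (f (G.clusterIn F ω A) * u (G.clusterIn F ω T)))
      = G.expec (fun ω => ind (Disjoint (G.clusterIn F ω T) A) *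
        (u (G.clusterIn F ω T) * G.expecAvoiding F A f (G.clusterIn F ω T))) := by
  induction F using Finset.strongInduction generalizing T with
  | H F ih =>
  by_cases hex : ∃ e ∈ F, ∃ x y, G.Joins e x y ∧ x ∈ T
  · obtain ⟨e, he, x, y, hj, hx⟩ := hex
    rw [expec_update G e, expec_update G e (fun ω => ind (Disjoint (G.clusterIn F ω T) A) * _)]
    have hav : ∀ ω T', T ⊆ T' →
        G.expecAvoiding (F.erase e) A f (G.clusterIn (F.erase e) ω T')
        = G.expecAvoiding F A f (G.clusterIn (F.erase e) ω T') := by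
      intro ω T' hT'
      unfold expecAvoiding
      rw [avoid_erase hj (subset_clusterIn (hT' hx))]
    have ih1 := ih _ (Finset.erase_ssubset he) (insert y T)
    have ih0 := ih _ (Finset.erase_ssubset he) T
    simp only [hav _ _ (Set.subset_insert y T)] at ih1
    simp only [hav _ _ (subset_refl T)] at ih0
    simp only [clusterIn_update_false, clusterIn_update_true he hj hx,
      disjoint_clusterIn_update_true he hj hx]
    rw [← ih1, ← ih0]
    congr 2
    congr 1
    funext ω
    by_cases hd : Disjoint (G.clusterIn (F.erase e) ω A) (insert y T)
    · rw [clusterIn_update_true_of_disjoint hj hx hd]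
    · rw [ind_of_false hd, zero_mul, zero_mul]
  · push Not at hex
    have hT : ∀ ω, G.clusterIn F ω T = T := fun ω => clusterIn_eq_self hex
    simp only [disjoint_clusterIn_comm (A := A) (T := T), hT, expecAvoiding, avoid_eq_self hex]
    have h1 : ∀ c d : ℝ, c * (u T * d) = (c * u T) * (d * 1) := fun c d => by ring
    rw [← mul_one (G.expec fun ω => ind _ * (u T * _))]
    have h2 : (fun ω => ind (Disjoint T A) * (f (G.clusterIn F ω A) * u T))
      = fun ω => (ind (Disjoint T A) * u T) * f (G.clusterIn F ω A) := by
      funext ω; ring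
    have h3 := expec_const_mul G (ind (Disjoint T A) *
      (u T * G.expec fun ω => f (G.clusterIn F ω A))) (fun _ => 1)
    simp only [mul_one] at h3 ⊢
    rw [h2, expec_const_mul, h3, expec_one]
    ring

/-- The covariance inequality for a mixture of two positively correlated measures that are
ordered on both test functions. -/
theorem mixture_correlation {q n₁ n₀ f₁ f₀ g₁ g₀ h₁ h₀ : ℝ} (hq : 0 ≤ q) (hq' : q ≤ 1)
    (hn₁ : 0 < n₁) (hn₀ : 0 < n₀) (c₁ : f₁ * g₁ ≤ h₁ * n₁) (c₀ : f₀ * g₀ ≤ h₀ * n₀)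
    (hf : f₀ * n₁ ≤ f₁ * n₀) (hg : g₀ * n₁ ≤ g₁ * n₀) :
    (q * f₁ + (1 - q) * f₀) * (q * g₁ + (1 - q) * g₀)
      ≤ (q * h₁ + (1 - q) * h₀) * (q * n₁ + (1 - q) * n₀) := by
  have hcross : f₁ * g₀ + f₀ * g₁ ≤ h₁ * n₀ + h₀ * n₁ := by
    have hpos : 0 < n₁ * n₀ := mul_pos hn₁ hn₀
    refine le_of_mul_le_mul_left ?_ hpos
    have h1 := mul_nonneg (sub_nonneg.2 hf) (sub_nonneg.2 hg)
    have h2 := mul_le_mul_of_nonneg_left c₁ (sq_nonneg n₀)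
    have h3 := mul_le_mul_of_nonneg_left c₀ (sq_nonneg n₁)
    nlinarith [h1, h2, h3]
  have hq1 : 0 ≤ 1 - q := by linarith
  have h1 := mul_le_mul_of_nonneg_left c₁ (mul_nonneg hq hq)
  have h2 := mul_le_mul_of_nonneg_left c₀ (mul_nonneg hq1 hq1)
  have h3 := mul_le_mul_of_nonneg_left hcross (mul_nonneg hq hq1)
  nlinarith [h1, h2, h3]

/-- The expectation of a function of the cluster of `A` on the event that it avoids `T`. -/
noncomputable def expecDisjoint (G : PercGraph V E) (F : Finset E) (A T : Set V)
    (f : Set V → ℝ) : ℝ :=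
  G.expec fun ω => ind (Disjoint (G.clusterIn F ω A) T) * f (G.clusterIn F ω A)

theorem expecDisjoint_mono (hp : G.ProbValid) (F : Finset E) (A T : Set V) {f g : Set V → ℝ}
    (h : ∀ S, f S ≤ g S) : G.expecDisjoint F A T f ≤ G.expecDisjoint F A T g :=
  expec_mono hp fun _ => mul_le_mul_of_nonneg_left (h _) (ind_nonneg _)

theorem expecDisjoint_nonneg (hp : G.ProbValid) (F : Finset E) (A T : Set V) {f : Set V → ℝ}
    (h : ∀ S, 0 ≤ f S) : 0 ≤ G.expecDisjoint F A T f :=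
  expec_nonneg hp fun _ => mul_nonneg (ind_nonneg _) (h _)

theorem expecDisjoint_neg (G : PercGraph V E) (F : Finset E) (A T : Set V) (f : Set V → ℝ) :
    G.expecDisjoint F A T (fun S => - f S) = - G.expecDisjoint F A T f := by
  simp only [expecDisjoint, mul_neg, expec_neg]

theorem expecDisjoint_eq_zero (hp : G.ProbValid) {F : Finset E} {A T : Set V}
    (h : G.expecDisjoint F A T (fun _ => 1) = 0) (f : Set V → ℝ) :
    G.expecDisjoint F A T f = 0 := by
  unfold expecDisjoint expec at h ⊢
  rw [Finset.sum_eq_zero_iff_of_nonneg fun ω _ =>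
    mul_nonneg (mul_nonneg (ind_nonneg _) zero_le_one) (weight_nonneg hp ω)] at h
  refine Finset.sum_eq_zero fun ω hω => ?_
  have := h ω hω
  rw [mul_one] at this
  rw [mul_right_comm, this, zero_mul]

theorem expecDisjoint_update {F : Finset E} {A T : Set V} {e : E} {x y : V} (he : e ∈ F)
    (hj : G.Joins e x y) (hx : x ∈ A) (f : Set V → ℝ) :
    G.expecDisjoint F A T f = G.p e * G.expecDisjoint (F.erase e) (insert y A) T f
      + (1 - G.p e) * G.expecDisjoint (F.erase e) A T f := by
  unfold expecDisjoint
  rw [expec_update G e]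
  simp only [clusterIn_update_false, clusterIn_update_true he hj hx]

theorem expecDisjoint_swap (G : PercGraph V E) (F : Finset E) (A T : Set V) (f : Set V → ℝ) :
    G.expecDisjoint F A T f = G.expecDisjoint F T A (G.expecAvoiding F A f) := by
  have h := expec_disjoint_clusters G F A T f (fun _ => 1)
  simp only [mul_one, one_mul] at h
  exact h

theorem expecDisjoint_insert (G : PercGraph V E) (F : Finset E) (A T : Set V) (y : V)
    (f : Set V → ℝ) :
    G.expecDisjoint F T (insert y A) f = G.expecDisjoint F T A (fun S => ind (y ∉ S) * f S) := by
  unfold expecDisjoint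
  congr 1
  funext ω
  rw [Set.disjoint_insert_right]
  by_cases h1 : y ∈ G.clusterIn F ω T <;> by_cases h2 : Disjoint (G.clusterIn F ω T) A <;>
    simp [ind, h1, h2]

/-- Conditionally on the cluster of `A` avoiding `T`, increasing functions of that cluster are
positively correlated (van den Berg, Häggström and Kahn). -/
theorem expecDisjoint_correlation (hp : G.ProbValid) (F : Finset E) (A T : Set V)
    {f g : Set V → ℝ} (hf : Monotone f) (hg : Monotone g) :
    G.expecDisjoint F A T f * G.expecDisjoint F A T g
      ≤ G.expecDisjoint F A T (fun S => f S * g S) * G.expecDisjoint F A T (fun _ => 1) := by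
  induction F using Finset.strongInduction generalizing A T f g with
  | H F ih =>
  by_cases hex : ∃ e ∈ F, ∃ x y, G.Joins e x y ∧ x ∈ A
  · obtain ⟨e, he, x, y, hj, hx⟩ := hex
    have hlt := Finset.erase_ssubset he
    simp only [expecDisjoint_update (T := T) he hj hx]
    have c₁ := ih _ hlt (insert y A) T hf hg
    have c₀ := ih _ hlt A T hf hg
    have hshift : ∀ k : Set V → ℝ, Monotone k →
        G.expecDisjoint (F.erase e) A T k *
            G.expecDisjoint (F.erase e) (insert y A) T (fun _ => 1)
          ≤ G.expecDisjoint (F.erase e) (insert y A) T k *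
            G.expecDisjoint (F.erase e) A T (fun _ => 1) := by
      intro k hk
      have hone : ∀ A', G.expecDisjoint (F.erase e) A' T (fun _ => 1)
          = G.expecDisjoint (F.erase e) T A' (fun _ => 1) := by
        intro A'
        simp only [expecDisjoint, disjoint_clusterIn_comm (A := A') (T := T)]
      have hi : Monotone fun S : Set V => - ind (y ∉ S) := fun S S' hS =>
        neg_le_neg (ind_mono fun h h' => h (hS h'))
      have hφ : Monotone fun S => - G.expecAvoiding (F.erase e) A k S := fun S S' hS =>
        neg_le_neg (expecAvoiding_antitone hp _ A hk hS)
      have hc := ih _ hlt T A hi hφ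
      simp only [expecDisjoint_neg, neg_mul_neg] at hc
      have hle : G.expecDisjoint (F.erase e) T A
            (fun S => ind (y ∉ S) * G.expecAvoiding (F.erase e) A k S)
          ≤ G.expecDisjoint (F.erase e) (insert y A) T k := by
        rw [expecDisjoint_swap _ _ _ _ k, expecDisjoint_insert]
        exact expecDisjoint_mono hp _ _ _ fun S => mul_le_mul_of_nonneg_left
          (expecAvoiding_mono_left hp _ hk (Set.subset_insert _ _) S) (ind_nonneg _)
      rw [hone, hone, expecDisjoint_insert, expecDisjoint_swap _ _ A T k]
      simp only [mul_one]
      rw [mul_comm]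
      exact hc.trans (mul_le_mul_of_nonneg_right hle
        (expecDisjoint_nonneg hp _ _ _ fun _ => zero_le_one))
    have hq := hp e
    have hn : ∀ A', 0 ≤ G.expecDisjoint (F.erase e) A' T (fun _ => 1) := fun A' =>
      expecDisjoint_nonneg hp _ _ _ fun _ => zero_le_one
    rcases (hn (insert y A)).eq_or_lt with h1 | h1
    · simp only [expecDisjoint_eq_zero hp h1.symm, mul_zero, zero_add]
      have := mul_le_mul_of_nonneg_left c₀ (mul_self_nonneg (1 - G.p e))
      linarith
    rcases (hn A).eq_or_lt with h0 | h0
    · simp only [expecDisjoint_eq_zero hp h0.symm, mul_zero, add_zero]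
      have := mul_le_mul_of_nonneg_left c₁ (mul_self_nonneg (G.p e))
      linarith
    exact mixture_correlation hq.1 hq.2 h1 h0 c₁ c₀ (hshift f hf) (hshift g hg)
  · push Not at hex
    have hA : ∀ ω, G.clusterIn F ω A = A := fun ω => clusterIn_eq_self hex
    have hk : ∀ k : Set V → ℝ, G.expecDisjoint F A T k = k A * ind (Disjoint A T) := by
      intro k
      simp only [expecDisjoint, hA]
      have := expec_const_mul G (ind (Disjoint A T) * k A) (fun _ => 1)
      simp only [mul_one] at this
      rw [this, expec_one]
      ring
    simp only [hk]
    apply le_of_eq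
    ring

end ConditionalAssociation

section Swap

variable {V E : Type} [Fintype E] [DecidableEq E] {G : PercGraph V E}

theorem mem_clusterIn_univ {ω : E → Bool} {x y : V} :
    y ∈ G.clusterIn Finset.univ ω {x} ↔ G.Conn ω x y := by
  have : restrict Finset.univ ω = ω := by funext e; simp [restrict]
  simp [clusterIn, this, cluster]

/-- If `v` is at least as likely as `a` to be connected to `b`, then wiring a set `B` containing
`v` together preserves this. -/
theorem expec_swap (hp : G.ProbValid) {a b v : V} {B : Set V} (hv : v ∈ B)
    (h : G.prob (G.connEvent a b) ≤ G.prob (G.connEvent v b)) :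
    G.expec (fun ω => ind (G.Conn ω a b ∧ ∀ u ∈ B, ¬ G.Conn ω a u))
      ≤ G.expec (fun ω => ind (G.Conn ω v b ∧ ∀ u ∈ B, ¬ G.Conn ω a u)) := by
  set N := G.expecDisjoint Finset.univ {a} {v} with hN
  set X : Set V → ℝ := fun S => ind (b ∈ S)
  set Y : Set V → ℝ := fun S => ind (∀ u ∈ B, u ∉ S)
  set Φ := G.expecAvoiding Finset.univ {v} X
  have hX : Monotone X := fun S S' hS => ind_mono fun h => hS h
  have hY : Monotone fun S => - Y S := fun S S' hS =>
    neg_le_neg (ind_mono fun h u hu hS' => h u hu (hS hS'))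
  have hΦ : Monotone fun S => - Φ S := fun S S' hS =>
    neg_le_neg (expecAvoiding_antitone hp _ _ hX hS)
  have hL : G.expec (fun ω => ind (G.Conn ω a b ∧ ∀ u ∈ B, ¬ G.Conn ω a u))
      = N (fun S => X S * Y S) := by
    simp only [hN, expecDisjoint, X, Y, Set.disjoint_singleton_right, mem_clusterIn_univ]
    congr 1
    funext ω
    by_cases h2 : ∀ u ∈ B, ¬ G.Conn ω a u
    · rw [ind_and, ind_of_true h2, ind_of_true (h2 v hv), one_mul]
    · rw [ind_and, ind_of_false h2, mul_zero, mul_zero]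
  have hmarkov : ∀ u : Set V → ℝ, N (fun S => u S * Φ S) = G.expec (fun ω =>
      ind (¬ G.Conn ω a v) * (ind (G.Conn ω v b) * u (G.clusterIn Finset.univ ω {a}))) := by
    intro u
    have := expec_disjoint_clusters G Finset.univ {v} {a} X u
    simp only [disjoint_clusterIn_comm (A := {v}) (T := {a})] at this
    simp only [hN, expecDisjoint, Φ]
    rw [← this]
    simp only [X, Set.disjoint_singleton_right, mem_clusterIn_univ]
  have hR : G.expec (fun ω => ind (G.Conn ω v b ∧ ∀ u ∈ B, ¬ G.Conn ω a u))
      = N (fun S => Y S * Φ S) := by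
    rw [hmarkov]
    simp only [Y, mem_clusterIn_univ]
    congr 1
    funext ω
    by_cases h2 : ∀ u ∈ B, ¬ G.Conn ω a u
    · rw [ind_and, ind_of_true h2, ind_of_true (h2 v hv), one_mul]
    · rw [ind_and, ind_of_false h2, mul_zero, mul_zero]
  have hXΦ : N X ≤ N Φ := by
    have hZ := hmarkov (fun _ => 1)
    simp only [one_mul, mul_one] at hZ
    have ea : G.prob (G.connEvent a b) = N X +
        G.expec (fun ω => ind (G.Conn ω a b ∧ G.Conn ω v b)) := by
      rw [prob_eq_expec, hN, expecDisjoint, ← expec_add]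
      simp only [X, Set.disjoint_singleton_right, mem_clusterIn_univ, connEvent, Set.mem_ofPred_eq]
      congr 1
      funext ω
      by_cases h1 : G.Conn ω a b
      · have : G.Conn ω a v ↔ G.Conn ω v b :=
          ⟨fun h => h.symm.trans h1, fun h => h1.trans h.symm⟩
        by_cases h2 : G.Conn ω v b <;> simp [ind, h1, h2, this]
      · simp [ind, h1]
    have ev : G.prob (G.connEvent v b) = N Φ +
        G.expec (fun ω => ind (G.Conn ω a b ∧ G.Conn ω v b)) := by
      rw [prob_eq_expec, hZ, ← expec_add]
      simp only [connEvent, Set.mem_ofPred_eq]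
      congr 1
      funext ω
      by_cases h1 : G.Conn ω v b
      · have : G.Conn ω a v ↔ G.Conn ω a b :=
          ⟨fun h => h.trans h1, fun h => h.trans h1.symm⟩
        by_cases h2 : G.Conn ω a b <;> simp [ind, h1, h2, this]
      · simp [ind, h1]
    linarith
  rw [hL, hR]
  have hY0 : 0 ≤ N Y := expecDisjoint_nonneg hp _ _ _ fun _ => ind_nonneg _
  have c1 := expecDisjoint_correlation hp Finset.univ {a} {v} hX hY
  have c2 := expecDisjoint_correlation hp Finset.univ {a} {v} hY hΦ
  simp only [mul_neg, expecDisjoint_neg, neg_mul, neg_neg] at c1 c2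
  rw [← hN] at c1 c2
  have hn : 0 ≤ N (fun _ => 1) := expecDisjoint_nonneg hp _ _ _ fun _ => zero_le_one
  rcases hn.eq_or_lt with h0 | h0
  · rw [hN, expecDisjoint_eq_zero hp h0.symm, expecDisjoint_eq_zero hp h0.symm]
  · have := mul_le_mul_of_nonneg_right hXΦ hY0
    refine le_of_mul_le_mul_right ?_ h0
    linarith

end Swap

section Deletion

variable {V E : Type} [DecidableEq V] [Fintype E] [DecidableEq E]

/-- The states of the edges incident to a deleted vertex are independent of the configuration
on the remaining graph. -/
theorem exists_expec_delete (G : PercGraph V E) (hp : G.ProbValid) (W : Finset V)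
    {σ : Set (E → Bool)}
    (hσ : ∀ ω ω' : E → Bool, (∀ e, ¬ ((G.ends e).1 ∉ W ∧ (G.ends e).2 ∉ W) → ω e = ω' e) →
      ω ∈ σ → ω' ∈ σ) :
    ∃ c : ℝ, 0 ≤ c ∧ ∀ f, G.expec (fun ω => f (fun e => ω e.1) * ind (ω ∈ σ))
      = c * (G.delete W).expec f := by
  let P : E → Prop := fun e => (G.ends e).1 ∉ W ∧ (G.ends e).2 ∉ W
  let Q := Equiv.piEquivPiSubtypeProd P (fun _ : E => Bool)
  let z : {e // P e} → Bool := fun _ => false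
  refine ⟨∑ η : {e // ¬ P e} → Bool, ind (Q.symm (z, η) ∈ σ) *
    ∏ e, (if η e then G.p e.1 else 1 - G.p e.1), ?_, ?_⟩
  · refine Finset.sum_nonneg fun η _ => mul_nonneg (ind_nonneg _)
      (Finset.prod_nonneg fun e _ => ?_)
    split_ifs
    · exact (hp e.1).1
    · linarith [(hp e.1).2]
  · intro f
    rw [expec, ← Equiv.sum_comp Q.symm, Fintype.sum_prod_type_right, Finset.sum_mul]
    refine Finset.sum_congr rfl fun η _ => ?_
    rw [expec, Finset.mul_sum]
    refine Finset.sum_congr rfl fun ξ _ => ?_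
    have h1 : ∀ ξ, (fun e : {e // P e} => Q.symm (ξ, η) e.1) = ξ := by
      intro ξ; funext e; simp [Q, Equiv.piEquivPiSubtypeProd, e.2]
    have h2 : ∀ ξ, (fun e : {e // ¬ P e} => Q.symm (ξ, η) e.1) = η := by
      intro ξ; funext e; simp [Q, Equiv.piEquivPiSubtypeProd, e.2]
    have hw : G.weight (Q.symm (ξ, η)) = (G.delete W).weight ξ *
        ∏ e, (if η e then G.p e.1 else 1 - G.p e.1) := by
      rw [weight, ← Fintype.prod_subtype_mul_prod_subtype P]
      congr 1
      · refine Finset.prod_congr rfl fun e _ => ?_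
        rw [congrFun (h1 ξ) e]; rfl
      · refine Finset.prod_congr rfl fun e _ => ?_
        rw [congrFun (h2 ξ) e]
    have hs : ind (Q.symm (ξ, η) ∈ σ) = ind (Q.symm (z, η) ∈ σ) := by
      have : ∀ ξ ξ', Q.symm (ξ, η) ∈ σ → Q.symm (ξ', η) ∈ σ := fun ξ ξ' =>
        hσ _ _ fun e he => (congrFun (h2 ξ) ⟨e, he⟩).trans (congrFun (h2 ξ') ⟨e, he⟩).symm
      exact le_antisymm (ind_mono (this _ _)) (ind_mono (this _ _))
    rw [hw, hs]
    change f (fun e : {e // P e} => Q.symm (ξ, η) e.1) * _ * _ = _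
    rw [h1]
    ring

end Deletion

end PercGraph

/-- if `a, v` are neighbours of `0` with
`P_{G∖{0}}(a↔b) ≤ P_{G∖{0}}(v↔b)`, `B` a set of neighbours of `0` containing `v`,
and `σ_B` prescribes exactly the edges from `0` to `B` to be open, then
`P(a↔b, σ_B) ≤ P(0↔b, σ_B)`. -/
theorem neighbour_swap
    {V E : Type} [DecidableEq V] [Fintype E] [DecidableEq E]
    (G : PercGraph V E) (hp : G.ProbValid) (x₀ b a v : V)
    (ha : ∃ e, G.ends e = (x₀, a) ∨ G.ends e = (a, x₀))
    (hv : ∃ e, G.ends e = (x₀, v) ∨ G.ends e = (v, x₀))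
    (h : (G.delete {x₀}).prob ((G.delete {x₀}).connEvent a b)
          ≤ (G.delete {x₀}).prob ((G.delete {x₀}).connEvent v b))
    (B : Finset V) (hB : ∀ u ∈ B, ∃ e, G.ends e = (x₀, u) ∨ G.ends e = (u, x₀))
    (hvB : v ∈ B)
    (σ : Set (E → Bool))
    (hσ : σ = {ω | ∀ e, G.incident x₀ e → (ω e = true ↔ G.otherEnd x₀ e ∈ B)}) :
    G.prob (G.connEvent a b ∩ σ) ≤ G.prob (G.connEvent x₀ b ∩ σ) := by
  subst hσ
  set σ : Set (E → Bool) :=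
    {ω | ∀ e, G.incident x₀ e → (ω e = true ↔ G.otherEnd x₀ e ∈ B)} with hσ
  by_cases hax : a = x₀
  · rw [hax]
  have hopen : ∀ ω ∈ σ, ∀ u ∈ B, G.Conn ω x₀ u := by
    intro ω hω u hu
    obtain ⟨e, he⟩ := hB u hu
    refine .single ⟨e, (hω e ?_).2 ?_, he⟩
    · rcases he with he | he <;> simp [PercGraph.incident, he]
    · rcases he with he | he
      · simpa [PercGraph.otherEnd, he] using hu
      · by_cases hux : u = x₀
        · simpa [PercGraph.otherEnd, he, hux] using hux ▸ hu
        · simpa [PercGraph.otherEnd, he, hux] using hu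
  have hconn : ∀ ω ∈ σ, (∀ u ∈ B, ¬ (G.delete {x₀}).Conn (fun e => ω e.1) a u) →
      ∀ y, G.Conn ω a y → (G.delete {x₀}).Conn (fun e => ω e.1) a y := by
    intro ω hω hno y hy
    induction hy with
    | refl => exact .refl
    | @tail y z _ hyz ih =>
      obtain ⟨e, ho, hj⟩ := hyz
      have hyx : y ≠ x₀ := by
        simpa using PercGraph.Conn.notMem_of_delete (by simpa using hax) ih
      by_cases hzx : z = x₀
      · refine absurd ih (hno y ?_)
        have hinc : G.incident x₀ e := by
          rcases hj with hj | hj <;> simp [PercGraph.incident, hj, hzx]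
        have := (hω e hinc).1 ho
        rcases hj with hj | hj <;> simpa [PercGraph.otherEnd, hj, hzx, hyx] using this
      · refine ih.tail ⟨⟨e, ?_⟩, ho, hj⟩
        rcases hj with hj | hj <;> simp [hj, hzx, hyx]
  obtain ⟨c, hc, hfac⟩ := PercGraph.exists_expec_delete G hp {x₀} (σ := σ) (by
    intro ω ω' hagree hω e he
    rw [← hagree e (by rcases he with he | he <;> simp [he])]
    exact hω e he)
  have hp' : (G.delete {x₀}).ProbValid := fun e => hp e.1
  have key := mul_le_mul_of_nonneg_left
    (PercGraph.expec_swap hp' (B := (B : Set V)) (Finset.mem_coe.2 hvB) h) hc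
  rw [← hfac, ← hfac] at key
  simp only [Finset.mem_coe] at key
  have hleft : G.prob (G.connEvent a b ∩ σ) ≤
      G.expec (fun ω => PercGraph.ind (G.Conn ω a b ∧ G.Conn ω x₀ b ∧ ω ∈ σ)) +
      G.expec (fun ω => PercGraph.ind ((G.delete {x₀}).Conn (fun e => ω e.1) a b ∧
        ∀ u ∈ B, ¬ (G.delete {x₀}).Conn (fun e => ω e.1) a u) * PercGraph.ind (ω ∈ σ)) := by
    rw [PercGraph.prob_eq_expec, ← PercGraph.expec_add]
    refine PercGraph.expec_mono hp fun ω => ?_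
    by_cases hω : ω ∈ G.connEvent a b ∩ σ
    · rw [PercGraph.ind_of_true hω]
      obtain ⟨hab, hωσ⟩ := hω
      by_cases h0 : G.Conn ω x₀ b
      · rw [PercGraph.ind_of_true ⟨hab, h0, hωσ⟩]
        exact le_add_of_nonneg_right
          (mul_nonneg (PercGraph.ind_nonneg _) (PercGraph.ind_nonneg _))
      · have hno : ∀ u ∈ B, ¬ (G.delete {x₀}).Conn (fun e => ω e.1) a u := fun u hu hau =>
          h0 ((hopen ω hωσ u hu).trans (hau.of_delete.symm.trans hab))
        have hL := And.intro (hconn ω hωσ hno b hab) hno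
        rw [PercGraph.ind_of_true hL, PercGraph.ind_of_true hωσ]
        linarith [PercGraph.ind_nonneg (G.Conn ω a b ∧ G.Conn ω x₀ b ∧ ω ∈ σ)]
    · rw [PercGraph.ind_of_false hω]
      exact add_nonneg (PercGraph.ind_nonneg _)
        (mul_nonneg (PercGraph.ind_nonneg _) (PercGraph.ind_nonneg _))
  have hright :
      G.expec (fun ω => PercGraph.ind (G.Conn ω a b ∧ G.Conn ω x₀ b ∧ ω ∈ σ)) +
      G.expec (fun ω => PercGraph.ind ((G.delete {x₀}).Conn (fun e => ω e.1) v b ∧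
        ∀ u ∈ B, ¬ (G.delete {x₀}).Conn (fun e => ω e.1) a u) * PercGraph.ind (ω ∈ σ))
      ≤ G.prob (G.connEvent x₀ b ∩ σ) := by
    rw [PercGraph.prob_eq_expec, ← PercGraph.expec_add]
    refine PercGraph.expec_mono hp fun ω => ?_
    by_cases hωσ : ω ∈ σ
    · rw [PercGraph.ind_of_true hωσ, mul_one]
      by_cases hR : (G.delete {x₀}).Conn (fun e => ω e.1) v b ∧
          ∀ u ∈ B, ¬ (G.delete {x₀}).Conn (fun e => ω e.1) a u
      · have hab : ¬ G.Conn ω a b := fun hab =>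
          hR.2 v hvB ((hconn ω hωσ hR.2 b hab).trans hR.1.symm)
        have h0 : G.Conn ω x₀ b := (hopen ω hωσ v hvB).trans hR.1.of_delete
        rw [PercGraph.ind_of_true hR, PercGraph.ind_of_false fun h => hab h.1,
          PercGraph.ind_of_true (show ω ∈ G.connEvent x₀ b ∩ σ from ⟨h0, hωσ⟩), zero_add]
      · rw [PercGraph.ind_of_false hR, add_zero]
        exact PercGraph.ind_mono fun h => ⟨h.2.1, h.2.2⟩
    · rw [PercGraph.ind_of_false hωσ, mul_zero, add_zero]
      exact PercGraph.ind_mono fun h => ⟨h.2.1, h.2.2⟩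
  linarith
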